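/- Let M > 0 and let u₀, u₁ : ℝⁿ → (−∞,+∞] be convex lower semicontinuous functions with −M ≤ uⱼ ≤ 0 on R̄₋ⁿ and uⱼ = +∞ on ℝⁿ \ R̄₋ⁿ (j = 0,1). For t ∈ [0,1] define w_t = 𝓛[(1−t)𝓛[u₀] + t𝓛[u₁]]. Then: (i) the function (x,t) ↦ w_t(x) is convex on ℝⁿ × [0,1]; (ii) w₀ = u₀ and w₁ = u₁; and (iii) for every convex lower semicontinuous function v : ℝⁿ × ℝ → (−∞,+∞] satisfying v(x,0) ≤ u₀(x) and v(x,1) ≤ u₁(x) for all x ∈ ℝⁿ, one has v(x,t) ≤ w_t(x) for all x ∈ ℝⁿ and t ∈ [0,1]. (This is the convex-image formulation of the representation of the geodesic between two bounded toric plurisubharmonic functions on the unit polydisk with zero boundary values: the Legendre transform of the convex image of the geodesic is affine in t.) -/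

import Mathlib

open Set MeasureTheory Pointwise

noncomputable section

abbrev En (n : ℕ) := EuclideanSpace ℝ (Fin n)

/-- Standard inner product on ℝⁿ. -/
def dotp {n : ℕ} (x y : En n) : ℝ := ∑ i, x i * y i

/-- Closed positive orthant R̄₊ⁿ. -/
def posOrthantCl (n : ℕ) : Set (En n) := {x | ∀ i, 0 ≤ x i}
/-- Open positive orthant R₊ⁿ. -/
def posOrthantOp (n : ℕ) : Set (En n) := {x | ∀ i, 0 < x i}
/-- Closed negative orthant R̄₋ⁿ. -/
def negOrthantCl (n : ℕ) : Set (En n) := {x | ∀ i, x i ≤ 0}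
/-- Open negative orthant R₋ⁿ. -/
def negOrthantOp (n : ℕ) : Set (En n) := {x | ∀ i, x i < 0}

/-- Copolar A° = {x : ⟨x,y⟩ ≤ −1 for all y ∈ A}. -/
def copolar {n : ℕ} (A : Set (En n)) : Set (En n) := {x | ∀ y ∈ A, dotp x y ≤ -1}

/-- Membership in C₊: closed convex subset of R̄₊ⁿ with A + R₊ⁿ ⊆ A. -/
def memCplus {n : ℕ} (A : Set (En n)) : Prop :=
  IsClosed A ∧ Convex ℝ A ∧ A ⊆ posOrthantCl n ∧ A + posOrthantOp n ⊆ A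

/-- Membership in C₋: closed convex subset of R̄₋ⁿ with A + R₋ⁿ ⊆ A. -/
def memCminus {n : ℕ} (A : Set (En n)) : Prop :=
  IsClosed A ∧ Convex ℝ A ∧ A ⊆ negOrthantCl n ∧ A + negOrthantOp n ⊆ A

/-- Membership in CC₊: member of C₊ with bounded complement in R̄₊ⁿ. -/
def memCCplus {n : ℕ} (P : Set (En n)) : Prop :=
  memCplus P ∧ Bornology.IsBounded (posOrthantCl n \ P)

/-- Membership in UC₋: nonempty member of C₋ contained in s* + R̄₋ⁿ for some s* ∈ R₋ⁿ. -/
def memUCminus {n : ℕ} (L : Set (En n)) : Prop :=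
  L.Nonempty ∧ memCminus L ∧ ∃ s ∈ negOrthantOp n, L ⊆ s +ᵥ negOrthantCl n

/-- Support function of a set, with values in EReal. -/
def suppFn {n : ℕ} (A : Set (En n)) (x : En n) : EReal := ⨆ y ∈ A, ((dotp x y : ℝ) : EReal)

/-- Legendre transform of an EReal-valued function. -/
def legendre {n : ℕ} (f : En n → EReal) (y : En n) : EReal :=
  ⨆ x, ((dotp x y : ℝ) : EReal) - f x

/-- Convexity of an EReal-valued function, expressed as convexity of its epigraph. -/
def epiConvex {V : Type*} [AddCommGroup V] [Module ℝ V] (f : V → EReal) : Prop :=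
  Convex ℝ {p : V × ℝ | f p.1 ≤ (p.2 : EReal)}
lemma dotp_eq_inner {n : ℕ} (x y : En n) : dotp x y = inner ℝ x y := by
  simp [dotp, PiLp.inner_apply, mul_comm]

lemma dotp_comm {n : ℕ} (x y : En n) : dotp x y = dotp y x := by
  simp [dotp, mul_comm]

lemma dotp_combo_left {n : ℕ} (a b : ℝ) (x x' y : En n) :
    dotp (a • x + b • x') y = a * dotp x y + b * dotp x' y := by
  simp [dotp_eq_inner, inner_add_left, real_inner_smul_left]

lemma dotp_combo_right {n : ℕ} (a b : ℝ) (x y y' : En n) :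
    dotp x (a • y + b • y') = a * dotp x y + b * dotp x y' := by
  simp [dotp_eq_inner, inner_add_right, real_inner_smul_right]

lemma dotp_smul_right {n : ℕ} (a : ℝ) (x y : En n) : dotp x (a • y) = a * dotp x y := by
  simp [dotp_eq_inner, real_inner_smul_right]

lemma zero_mem_negOrthantCl (n : ℕ) : (0 : En n) ∈ negOrthantCl n := by
  simp [negOrthantCl]

lemma dotp_nonpos {n : ℕ} {x y : En n} (hx : x ∈ negOrthantCl n) (hy : y ∈ posOrthantCl n) :
    dotp x y ≤ 0 :=
  Finset.sum_nonpos fun i _ => mul_nonpos_of_nonpos_of_nonneg (hx i) (hy i)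

lemma legendre_le_coe_iff {n : ℕ} (f : En n → EReal) (y : En n) (c : ℝ) :
    legendre f y ≤ (c : EReal) ↔ ∀ x, ((dotp x y - c : ℝ) : EReal) ≤ f x := by
  rw [legendre, iSup_le_iff]
  refine forall_congr' fun x => ?_
  induction f x with
  | bot => simp [-EReal.coe_sub]
  | top => simp
  | coe r =>
    rw [← EReal.coe_sub, EReal.coe_le_coe_iff, EReal.coe_le_coe_iff, sub_le_comm]

lemma legendre_antitone {n : ℕ} : Antitone (legendre (n := n)) := fun _ _ h _ =>
  iSup_mono fun x => EReal.sub_le_sub le_rfl (h x)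

lemma legendre_legendre_le {n : ℕ} (f : En n → EReal) (x : En n) :
    legendre (legendre f) x ≤ f x := by
  refine EReal.le_of_forall_lt_iff_le.1 fun c hc => ?_
  rw [legendre_le_coe_iff]
  intro y
  refine EReal.le_of_forall_lt_iff_le.1 fun d hd => ?_
  have h := ((legendre_le_coe_iff f y d).1 hd.le x).trans hc.le
  rw [EReal.coe_le_coe_iff] at h ⊢
  rw [dotp_comm]
  linarith

lemma lt_legendre_legendre {n : ℕ} (f : En n → EReal) {x₀ y : En n} {r c : ℝ}
    (hf : ∀ x, ((dotp x y - c : ℝ) : EReal) ≤ f x) (hr : r < dotp x₀ y - c) :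
    (r : EReal) < legendre (legendre f) x₀ := by
  by_contra! h
  have h1 := (legendre_le_coe_iff _ _ _).1 h y
  have h2 := h1.trans ((legendre_le_coe_iff f y c).2 hf)
  rw [EReal.coe_le_coe_iff, dotp_comm] at h2
  linarith

lemma isClosed_real_epigraph {V : Type*} [TopologicalSpace V] {f : V → EReal}
    (hf : LowerSemicontinuous f) : IsClosed {p : V × ℝ | f p.1 ≤ (p.2 : EReal)} :=
  hf.isClosed_epigraph.preimage
    (f := fun p : V × ℝ => (p.1, (p.2 : EReal)))
    (continuous_fst.prodMk (continuous_coe_real_ereal.comp continuous_snd))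

/-- Fenchel–Moreau for convex lower semicontinuous functions bounded below. -/
lemma le_legendre_legendre {n : ℕ} {f : En n → EReal} (hc : epiConvex f)
    (hl : LowerSemicontinuous f) {m : ℝ} (hm : ∀ x, (m : EReal) ≤ f x) (x₀ : En n) :
    f x₀ ≤ legendre (legendre f) x₀ := by
  refine EReal.ge_of_forall_gt_iff_ge.1 fun r hr => ?_
  have hnot : (x₀, r) ∉ {p : En n × ℝ | f p.1 ≤ (p.2 : EReal)} := by simpa using hr
  obtain ⟨φ, c, hφ, hφ'⟩ :=
    geometric_hahn_banach_point_closed hc (isClosed_real_epigraph hl) hnot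
  obtain ⟨y, hy⟩ : ∃ y : En n, ∀ x, dotp x y = φ (x, 0) := by
    refine ⟨(InnerProductSpace.toDual ℝ (En n)).symm
      (φ.comp (ContinuousLinearMap.inl ℝ (En n) ℝ)), fun x => ?_⟩
    rw [dotp_eq_inner, real_inner_comm, InnerProductSpace.toDual_symm_apply]
    simp
  set s := φ (0, 1)
  have hdec : ∀ x ρ, φ (x, ρ) = dotp x y + ρ * s := by
    intro x ρ
    rw [hy, ← smul_eq_mul, ← map_smul, ← map_add]
    simp
  rw [hdec] at hφ
  have hepi : ∀ x (ρ : ℝ), f x ≤ (ρ : EReal) → c < dotp x y + ρ * s := fun x ρ h => by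
    rw [← hdec]; exact hφ' (x, ρ) h
  by_cases hdom : ∀ x, f x = ⊤
  · refine (lt_legendre_legendre f (y := 0) (c := -(r + 1)) (fun x => by simp [hdom x]) ?_).le
    simp [dotp]
  push Not at hdom
  obtain ⟨x₁, hx₁⟩ := hdom
  have hbot : ∀ x, f x ≠ ⊥ := fun x h => by simpa [h] using hm x
  have hs : 0 ≤ s := by
    by_contra! hs
    set ρ₁ := (f x₁).toReal with hρ₁
    have hfx : f x₁ = ρ₁ := (EReal.coe_toReal hx₁ (hbot x₁)).symm
    set ρ := max ρ₁ ((c - dotp x₁ y) / s) with hρ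
    have h1 := hepi x₁ ρ (by rw [hfx]; exact_mod_cast le_max_left _ _)
    have h2 : (c - dotp x₁ y) / s ≤ ρ := le_max_right _ _
    rw [div_le_iff_of_neg hs] at h2
    linarith
  have key : ∀ x, f x = ⊤ ∨ ∃ ρ : ℝ, f x = ρ ∧ m ≤ ρ ∧ c < dotp x y + ρ * s := by
    intro x
    rcases eq_or_ne (f x) ⊤ with h | h
    · exact Or.inl h
    · have hfx : f x = (f x).toReal := (EReal.coe_toReal h (hbot x)).symm
      have := hm x
      rw [hfx] at this
      exact Or.inr ⟨_, hfx, by exact_mod_cast this, hepi x _ hfx.le⟩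
  rcases hs.eq_or_lt with hs | hs
  · rw [← hs, mul_zero, add_zero] at hφ
    have hpos : 0 < c - dotp x₀ y := by linarith
    set k := (|r - m| + 1) / (c - dotp x₀ y) with hk
    have hk0 : 0 ≤ k := by positivity
    have hkc : k * (c - dotp x₀ y) = |r - m| + 1 := div_mul_cancel₀ _ hpos.ne'
    refine (lt_legendre_legendre f (y := (-k) • y) (c := -m - k * c) (fun x => ?_) ?_).le
    · rcases key x with h | ⟨ρ, h, hmρ, hcρ⟩
      · simp [h]
      · rw [h, EReal.coe_le_coe_iff, dotp_smul_right]
        rw [← hs] at hcρ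
        nlinarith
    · rw [dotp_smul_right]
      have := le_abs_self (r - m)
      linarith
  · refine (lt_legendre_legendre f (y := (-s⁻¹) • y) (c := -s⁻¹ * c) (fun x => ?_) ?_).le
    · rcases key x with h | ⟨ρ, h, -, hcρ⟩
      · simp [h]
      · rw [h, EReal.coe_le_coe_iff, dotp_smul_right]
        have : s⁻¹ * c ≤ s⁻¹ * (dotp x y + ρ * s) := by gcongr
        have h2 : s⁻¹ * (ρ * s) = ρ := by field_simp
        linarith
    · rw [dotp_smul_right]
      have : s⁻¹ * (dotp x₀ y + r * s) < s⁻¹ * c := by gcongr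
      have h2 : s⁻¹ * (r * s) = r := by field_simp
      linarith

lemma legendre_eq_top {n : ℕ} {f : En n → EReal} (hf : ∀ x ∈ negOrthantCl n, f x ≤ 0)
    {y : En n} (hy : y ∉ posOrthantCl n) : legendre f y = ⊤ := by
  simp only [posOrthantCl, mem_ofPred_eq, not_forall, not_le] at hy
  obtain ⟨i, hi⟩ := hy
  refine EReal.eq_top_iff_forall_lt _ |>.2 fun c => ?_
  by_contra! h
  rw [legendre_le_coe_iff] at h
  set k := (|c| + 1) / y i with hk
  have hk0 : k ≤ 0 := div_nonpos_of_nonneg_of_nonpos (by positivity) hi.le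
  have hky : k * y i = |c| + 1 := div_mul_cancel₀ _ hi.ne
  have hmem : EuclideanSpace.single i k ∈ negOrthantCl n := by
    intro j
    by_cases hj : j = i <;> simp [hj, hk0]
  have h1 := (h _).trans (hf _ hmem)
  have h2 : dotp (EuclideanSpace.single i k) y = k * y i := by
    simp [dotp]
  rw [h2, hky, ← EReal.coe_zero, EReal.coe_le_coe_iff] at h1
  linarith [le_abs_self c]

lemma exists_legendre_eq_coe {n : ℕ} {f : En n → EReal} {M : ℝ}
    (hb : ∀ x ∈ negOrthantCl n, ((-M : ℝ) : EReal) ≤ f x ∧ f x ≤ 0)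
    (ho : ∀ x ∉ negOrthantCl n, f x = ⊤) {y : En n} (hy : y ∈ posOrthantCl n) :
    ∃ a : ℝ, legendre f y = a := by
  have hle : legendre f y ≤ (M : EReal) := by
    rw [legendre_le_coe_iff]
    intro x
    by_cases hx : x ∈ negOrthantCl n
    · refine le_trans ?_ (hb x hx).1
      rw [EReal.coe_le_coe_iff]
      linarith [dotp_nonpos hx hy]
    · simp [ho x hx]
  have hbot : legendre f y ≠ ⊥ := by
    intro h
    have h1 := (legendre_le_coe_iff f y (-1)).1 (by simp [h]) 0
    have h2 := h1.trans (hb 0 (zero_mem_negOrthantCl n)).2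
    rw [← EReal.coe_zero, EReal.coe_le_coe_iff] at h2
    simp [dotp] at h2
    linarith
  exact ⟨_, (EReal.coe_toReal (ne_top_of_le_ne_top (EReal.coe_ne_top M) hle) hbot).symm⟩

lemma mul_le_of_legendre_eq_coe {n : ℕ} {f : En n → EReal} {y : En n} {a l d : ℝ}
    (ha : legendre f y = a) (hbot : ∀ x, f x ≠ ⊥) (hfin : ∃ x, f x ≠ ⊤) (hl : 0 ≤ l)
    (h : ∀ x (p : ℝ), f x = p → l * (dotp x y - p) ≤ d) : l * a ≤ d := by
  rcases hl.eq_or_lt with rfl | hl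
  · obtain ⟨x, hx⟩ := hfin
    simpa using h x _ (EReal.coe_toReal hx (hbot x)).symm
  · suffices hle : legendre f y ≤ ((d / l : ℝ) : EReal) by
      rwa [ha, EReal.coe_le_coe_iff, le_div_iff₀' hl] at hle
    rw [legendre_le_coe_iff]
    intro x
    by_cases hx : f x = ⊤
    · simp [hx]
    · have hfx := (EReal.coe_toReal hx (hbot x)).symm
      have := h x _ hfx
      rw [hfx, EReal.coe_le_coe_iff, sub_le_comm]
      rwa [le_div_iff₀' hl]

lemma coe_mul_top_add_coe_mul_top {t : ℝ} (ht : t ∈ Icc (0 : ℝ) 1) :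
    ((1 - t : ℝ) : EReal) * ⊤ + (t : EReal) * ⊤ = ⊤ := by
  rcases ht.1.eq_or_lt with rfl | h0
  · simp
  rcases ht.2.eq_or_lt with rfl | h1
  · simp
  · rw [EReal.coe_mul_top_of_pos (sub_pos.2 h1), EReal.coe_mul_top_of_pos h0, EReal.top_add_top]

/-- Representation of the geodesic between two bounded toric psh functions,
in convex-image formulation: w_t = 𝓛[(1−t)𝓛[u₀] + t𝓛[u₁]] is (i) jointly convex in (x,t)
on ℝⁿ × [0,1], (ii) has boundary values u₀, u₁, and (iii) dominates every convex lsc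
function v on ℝⁿ × ℝ with v(·,0) ≤ u₀ and v(·,1) ≤ u₁. -/
theorem toric_geodesic_representation (n : ℕ) (hn : 1 ≤ n) (M : ℝ) (hM : 0 < M)
    (u0 u1 : En n → EReal)
    (hc0 : epiConvex u0) (hc1 : epiConvex u1)
    (hl0 : LowerSemicontinuous u0) (hl1 : LowerSemicontinuous u1)
    (hb0 : ∀ x ∈ negOrthantCl n, ((-M : ℝ) : EReal) ≤ u0 x ∧ u0 x ≤ 0)
    (hb1 : ∀ x ∈ negOrthantCl n, ((-M : ℝ) : EReal) ≤ u1 x ∧ u1 x ≤ 0)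
    (ho0 : ∀ x ∉ negOrthantCl n, u0 x = ⊤)
    (ho1 : ∀ x ∉ negOrthantCl n, u1 x = ⊤)
    (w : ℝ → En n → EReal)
    (hw : ∀ t ∈ Set.Icc (0:ℝ) 1, ∀ x, w t x =
      legendre (fun y => ((1 - t : ℝ) : EReal) * legendre u0 y
        + ((t : ℝ) : EReal) * legendre u1 y) x) :
    Convex ℝ {p : (En n × ℝ) × ℝ |
        p.1.2 ∈ Set.Icc (0:ℝ) 1 ∧ w p.1.2 p.1.1 ≤ (p.2 : EReal)} ∧
    (∀ x, w 0 x = u0 x) ∧ (∀ x, w 1 x = u1 x) ∧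
    (∀ v : En n × ℝ → EReal, epiConvex v → LowerSemicontinuous v →
      (∀ x, v (x, 0) ≤ u0 x) → (∀ x, v (x, 1) ≤ u1 x) →
      ∀ x : En n, ∀ t ∈ Set.Icc (0:ℝ) 1, v (x, t) ≤ w t x) := by
  have hge : ∀ u : En n → EReal, (∀ x ∈ negOrthantCl n, ((-M : ℝ) : EReal) ≤ u x ∧ u x ≤ 0) →
      (∀ x ∉ negOrthantCl n, u x = ⊤) → ∀ x, ((-M : ℝ) : EReal) ≤ u x := by
    intro u hb ho x
    by_cases hx : x ∈ negOrthantCl n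
    · exact (hb x hx).1
    · simp [ho x hx]
  have hge0 := hge u0 hb0 ho0
  have hge1 := hge u1 hb1 ho1
  have hbot : ∀ u : En n → EReal, (∀ x, ((-M : ℝ) : EReal) ≤ u x) → ∀ x, u x ≠ ⊥ :=
    fun u hu x h => by simpa [h, -EReal.coe_neg] using hu x
  have hfin : ∀ u : En n → EReal, (∀ x ∈ negOrthantCl n, ((-M : ℝ) : EReal) ≤ u x ∧ u x ≤ 0) →
      ∃ x, u x ≠ ⊤ := fun u hb =>
    ⟨0, ne_top_of_le_ne_top EReal.zero_ne_top (hb 0 (zero_mem_negOrthantCl n)).2⟩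
  have htop0 : ∀ y ∉ posOrthantCl n, legendre u0 y = ⊤ := fun y hy =>
    legendre_eq_top (fun x hx => (hb0 x hx).2) hy
  have htop1 : ∀ y ∉ posOrthantCl n, legendre u1 y = ⊤ := fun y hy =>
    legendre_eq_top (fun x hx => (hb1 x hx).2) hy
  choose! a ha using fun y (hy : y ∈ posOrthantCl n) => exists_legendre_eq_coe hb0 ho0 hy
  choose! b hb using fun y (hy : y ∈ posOrthantCl n) => exists_legendre_eq_coe hb1 ho1 hy
  refine ⟨?_, ?_, ?_, ?_⟩
  · have hmem : ∀ t ∈ Icc (0 : ℝ) 1, ∀ x (r : ℝ), w t x ≤ (r : EReal) ↔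
        ∀ y ∈ posOrthantCl n, dotp y x - r ≤ (1 - t) * a y + t * b y := by
      intro t ht x r
      rw [hw t ht, legendre_le_coe_iff]
      refine forall_congr' fun y => ?_
      by_cases hy : y ∈ posOrthantCl n
      · rw [ha y hy, hb y hy]
        norm_cast
        simp [hy]
      · rw [htop0 y hy, htop1 y hy, coe_mul_top_add_coe_mul_top ht]
        simp [hy]
    rintro ⟨⟨x, t⟩, r⟩ ⟨ht, hp⟩ ⟨⟨x', t'⟩, r'⟩ ⟨ht', hp'⟩ α β hα hβ hαβ
    have hmix : α • t + β • t' ∈ Icc (0 : ℝ) 1 := convex_Icc 0 1 ht ht' hα hβ hαβ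
    refine ⟨hmix, (hmem _ hmix _ _).2 fun y hy => ?_⟩
    have h1 := mul_le_mul_of_nonneg_left ((hmem t ht x r).1 hp y hy) hα
    have h2 := mul_le_mul_of_nonneg_left ((hmem t' ht' x' r').1 hp' y hy) hβ
    simp only [Prod.smul_mk, Prod.mk_add_mk, smul_eq_mul, dotp_combo_right]
    have h3 : a y = (α + β) * a y := by rw [hαβ, one_mul]
    linear_combination h1 + h2 - h3
  · intro x
    rw [hw 0 (by simp)]
    simp only [sub_zero, EReal.coe_one, EReal.coe_zero, one_mul, zero_mul, add_zero]
    exact le_antisymm (legendre_legendre_le u0 x) (le_legendre_legendre hc0 hl0 hge0 x)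
  · intro x
    rw [hw 1 (by simp)]
    simp only [sub_self, EReal.coe_one, EReal.coe_zero, one_mul, zero_mul, zero_add]
    exact le_antisymm (legendre_legendre_le u1 x) (le_legendre_legendre hc1 hl1 hge1 x)
  · intro v hvc hvl hv0 hv1 x t ht
    have ht0 : 0 ≤ 1 - t := sub_nonneg.2 ht.2
    set g : En n → EReal := fun z => v (z, t) ⊔ ((-M : ℝ) : EReal) with hg
    have hgc : epiConvex g := by
      rintro ⟨z, r⟩ hz ⟨z', r'⟩ hz' α β hα hβ hαβ
      simp only [hg, mem_ofPred_eq, sup_le_iff, EReal.coe_le_coe_iff] at hz hz'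
      simp only [hg, mem_ofPred_eq, sup_le_iff, EReal.coe_le_coe_iff]
      refine ⟨?_, convex_Ici (-M) hz.2 hz'.2 hα hβ hαβ⟩
      have h := hvc (x := ((z, t), r)) hz.1 (y := ((z', t), r')) hz'.1 hα hβ hαβ
      simpa [← add_mul, hαβ] using h
    have hgl : LowerSemicontinuous g :=
      (LowerSemicontinuous.comp hvl (by fun_prop : Continuous fun z : En n => (z, t))).sup
        lowerSemicontinuous_const
    have hgm : ∀ z, ((-M : ℝ) : EReal) ≤ g z := fun z => le_sup_right
    have hgle : ∀ z z' (p q : ℝ), u0 z = p → u1 z' = q →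
        g ((1 - t) • z + t • z') ≤ (((1 - t) * p + t * q : ℝ) : EReal) := by
      intro z z' p q hp hq
      refine sup_le ?_ ?_
      · have h := hvc (x := ((z, 0), p)) ((hv0 z).trans hp.le) (y := ((z', 1), q))
          ((hv1 z').trans hq.le) ht0 ht.1 (by ring)
        simpa using h
      · have h1 := hge0 z
        have h2 := hge1 z'
        rw [hp, EReal.coe_le_coe_iff] at h1
        rw [hq, EReal.coe_le_coe_iff] at h2
        rw [EReal.coe_le_coe_iff]
        exact convex_Ici (-M) h1 h2 ht0 ht.1 (by ring)
    have hgnonpos : ∀ z ∈ negOrthantCl n, g z ≤ 0 := by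
      intro z hz
      have hp := EReal.coe_toReal (ne_top_of_le_ne_top EReal.zero_ne_top (hb0 z hz).2)
        (hbot u0 hge0 z)
      have hq := EReal.coe_toReal (ne_top_of_le_ne_top EReal.zero_ne_top (hb1 z hz).2)
        (hbot u1 hge1 z)
      have h := hgle z z _ _ hp.symm hq.symm
      rw [← add_smul, sub_add_cancel, one_smul] at h
      refine h.trans ?_
      have h1 := (hb0 z hz).2
      have h2 := (hb1 z hz).2
      rw [← hp, ← EReal.coe_zero, EReal.coe_le_coe_iff] at h1
      rw [← hq, ← EReal.coe_zero, EReal.coe_le_coe_iff] at h2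
      rw [← EReal.coe_zero, EReal.coe_le_coe_iff]
      exact convex_Iic (0 : ℝ) h1 h2 ht0 ht.1 (by ring)
    rw [hw t ht]
    refine le_sup_left.trans ((le_legendre_legendre hgc hgl hgm x).trans
      (legendre_antitone (fun y => ?_) x))
    by_cases hy : y ∈ posOrthantCl n
    · refine EReal.le_of_forall_lt_iff_le.1 fun c hc => ?_
      have hc' := (legendre_le_coe_iff g y c).1 hc.le
      rw [ha y hy, hb y hy, ← EReal.coe_mul, ← EReal.coe_mul, ← EReal.coe_add,
        EReal.coe_le_coe_iff, ← le_sub_iff_add_le]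
      refine mul_le_of_legendre_eq_coe (ha y hy) (hbot u0 hge0) (hfin u0 hb0) ht0
        fun z p hp => ?_
      rw [le_sub_comm]
      refine mul_le_of_legendre_eq_coe (hb y hy) (hbot u1 hge1) (hfin u1 hb1) ht.1
        fun z' q hq => ?_
      have h := (hc' _).trans (hgle z z' p q hp hq)
      rw [EReal.coe_le_coe_iff, dotp_combo_left] at h
      linarith
    · rw [legendre_eq_top hgnonpos hy]
      exact le_top
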